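/- For all real numbers θ_1, …, θ_n and every sign ε = ±1: [ ∏_{α=1}^{n} ( cos(θ_α/2)·I + sin(θ_α/2)·γ'_{2α−1} γ'_{2α} ) ] · u(ε,…,ε) = e^{(iε/2) Σ_{α} θ_α} · u(ε,…,ε) (the factors in the product commute, so the order is irrelevant). In particular, multiplying by the scalar e^{(i/2) Σ_α θ_α}, the element ℓ(A) := e^{(i/2)Σθ_α} · ∏_α (cos(θ_α/2) + sin(θ_α/2) γ'_{2α−1}γ'_{2α}) associated with the diagonal unitary matrix A = diag(e^{iθ_1},…,e^{iθ_n}) fixes u(−1,…,−1) and multiplies u(1,…,1) by det A = e^{i Σ_α θ_α}. -/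

import Mathlib

open Matrix Complex

noncomputable section

/-- The 2×2 matrix `U = [[i,0],[0,-i]]`. -/
def matU : Matrix (Fin 2) (Fin 2) ℂ := !![Complex.I, 0; 0, -Complex.I]

/-- The 2×2 matrix `V = [[0,i],[i,0]]`. -/
def matV : Matrix (Fin 2) (Fin 2) ℂ := !![0, Complex.I; Complex.I, 0]

/-- The 2×2 identity matrix `E`. -/
def matE : Matrix (Fin 2) (Fin 2) ℂ := !![1, 0; 0, 1]

/-- The 2×2 matrix `T = [[0,-i],[i,0]]`. -/
def matT : Matrix (Fin 2) (Fin 2) ℂ := !![0, -Complex.I; Complex.I, 0]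

/-- `epsC k j = ε_j`:  `-1` for `j ≤ k` and `1` for `j > k` (1-based index `j`). -/
def epsC (k j : ℕ) : ℂ := if j ≤ k then -1 else 1

/-- `tauC k j = τ_j`:  `i` for `j ≤ k` and `1` for `j > k` (1-based index `j`). -/
def tauC (k j : ℕ) : ℂ := if j ≤ k then Complex.I else 1

/-- The 2×2 factor sitting in slot `α` (0-based, slot `0` is the leftmost tensor factor)
of the iterated Kronecker product defining `γ_l` (1-based `l`): for `l = 2j-1` resp.
`l = 2j` this product is `E^{⊗(m-j)} ⊗ U ⊗ T^{⊗(j-1)}` resp. `E^{⊗(m-j)} ⊗ V ⊗ T^{⊗(j-1)}`. -/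
def gammaFac (m l : ℕ) (α : Fin m) : Matrix (Fin 2) (Fin 2) ℂ :=
  if (α : ℕ) < m - (l + 1) / 2 then matE
  else if (α : ℕ) = m - (l + 1) / 2 then (if l % 2 = 1 then matU else matV) else matT

/-- `γ_l = τ_l · (E^{⊗(m-j)} ⊗ U/V ⊗ T^{⊗(j-1)})` as a `2^m × 2^m` matrix whose rows and
columns are indexed by `Fin m → Fin 2` (identifying `ℂ^{2^m}` with the `m`-fold Kronecker
power of `ℂ²`, slot `0` being the leftmost factor). -/
def gammaM (m k l : ℕ) : Matrix (Fin m → Fin 2) (Fin m → Fin 2) ℂ :=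
  Matrix.of fun i i' => tauC k l * ∏ α, gammaFac m l α (i α) (i' α)

/-- `u(δ) = (1/√2)(1, -δ i) ∈ ℂ²`. -/
def uVec (δ : ℤ) : Fin 2 → ℂ :=
  fun t => if t = 0 then (Real.sqrt 2 : ℂ)⁻¹ else -(δ : ℂ) * Complex.I * (Real.sqrt 2 : ℂ)⁻¹

/-- `u(δ₁,…,δ_m) = u(δ₁) ⊗ ⋯ ⊗ u(δ_m) ∈ ℂ^{2^m}`. -/
def uProd (m : ℕ) (δ : Fin m → ℤ) : (Fin m → Fin 2) → ℂ :=
  fun i => ∏ α, uVec (δ α) (i α)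

/-- The standard Hermitian inner product, conjugate-linear in the second argument. -/
def hermIP {ι : Type*} [Fintype ι] (x y : ι → ℂ) : ℂ :=
  ∑ i, x i * (starRingEnd ℂ) (y i)

/-- The product `γ_1 γ_2 ⋯ γ_{2m}`. -/
def gammaVol (m k : ℕ) : Matrix (Fin m → Fin 2) (Fin m → Fin 2) ℂ :=
  ((List.range (2 * m)).map fun l => gammaM m k (l + 1)).prod

/-- The eigenspace `Δ^ε_{2m,k}` of `γ_1 γ_2 ⋯ γ_{2m}` for the eigenvalue `ε · i^{m+k}`. -/
def DeltaSp (m k : ℕ) (ε : ℤ) : Submodule ℂ ((Fin m → Fin 2) → ℂ) :=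
  Module.End.eigenspace (Matrix.toLin' (gammaVol m k)) ((ε : ℂ) * Complex.I ^ (m + k))

/-- The indefinite inner product `⟨u,v⟩ := (γ_1 u, v)` (here `k = 1`). -/
def indefIP (m : ℕ) (u v : (Fin m → Fin 2) → ℂ) : ℂ :=
  hermIP ((gammaM m 1 1).mulVec u) v

/-- The canonical vector `V_u` of a spinor `u`, with components
`(V_u)_j = -ε_j ⟨γ_j u, u⟩` (here `k = 1`). -/
def canV (m : ℕ) (u : (Fin m → Fin 2) → ℂ) : Fin (2 * m) → ℂ :=
  fun j => -(epsC 1 ((j : ℕ) + 1)) * indefIP m ((gammaM m 1 ((j : ℕ) + 1)).mulVec u) u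

/-- `x ⊗ v` under the identification `ℂ^{2^{n+1}} = ℂ^{2^n} ⊗ ℂ²` (the `ℂ²` factor last). -/
def tensP (n : ℕ) (x : (Fin n → Fin 2) → ℂ) (v : Fin 2 → ℂ) : (Fin (n + 1) → Fin 2) → ℂ :=
  fun i => x (Fin.init i) * v (i (Fin.last n))

/-- `Ω₀ = Σ_α γ'_{2α-1} γ'_{2α}` (here `k = 0`). -/
def OmegaZero (n : ℕ) : Matrix (Fin n → Fin 2) (Fin n → Fin 2) ℂ :=
  ∑ α : Fin n, gammaM n 0 (2 * (α : ℕ) + 1) * gammaM n 0 (2 * (α : ℕ) + 2)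

end
/-- The Kronecker product of a family of matrices. -/
def kroneckerFamily {ι κ R : Type*} [Fintype ι] [CommSemiring R] (A : ι → Matrix κ κ R) :
    Matrix (ι → κ) (ι → κ) R :=
  Matrix.of fun i j => ∏ a, A a (i a) (j a)

section kroneckerFamily

variable {ι κ R : Type*} [Fintype ι] [DecidableEq ι] [Fintype κ] [CommSemiring R]

theorem kroneckerFamily_mul (A B : ι → Matrix κ κ R) :
    kroneckerFamily A * kroneckerFamily B = kroneckerFamily fun a => A a * B a := by
  ext i j
  simp only [kroneckerFamily, Matrix.mul_apply, Matrix.of_apply, Finset.prod_univ_sum,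
    Fintype.piFinset_univ, Finset.prod_mul_distrib]

theorem kroneckerFamily_mulVec (A : ι → Matrix κ κ R) (v : ι → κ → R) :
    (kroneckerFamily A).mulVec (fun i => ∏ a, v a (i a)) =
      fun i => ∏ a, (A a).mulVec (v a) (i a) := by
  ext i
  simp only [kroneckerFamily, Matrix.mulVec, dotProduct, Matrix.of_apply, Finset.prod_univ_sum,
    Fintype.piFinset_univ, Finset.prod_mul_distrib]

end kroneckerFamily

theorem gammaM_zero_right (m l : ℕ) (hl : 1 ≤ l) :
    gammaM m 0 l = kroneckerFamily (gammaFac m l) := by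
  ext i j
  simp [gammaM, kroneckerFamily, tauC, Nat.ne_of_gt hl]

theorem matE_eq_one : matE = 1 := by
  ext i j; fin_cases i <;> fin_cases j <;> simp [matE]

theorem matT_mul_self : matT * matT = 1 := by
  ext i j; fin_cases i <;> fin_cases j <;> simp [matT]

theorem gammaFac_mul_gammaFac_succ (m j : ℕ) (a : Fin m) :
    gammaFac m (2 * j + 1) a * gammaFac m (2 * j + 2) a =
      if (a : ℕ) = m - (j + 1) then matU * matV else 1 := by
  have h1 : (2 * j + 1 + 1) / 2 = j + 1 := by omega
  have h2 : (2 * j + 2 + 1) / 2 = j + 1 := by omega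
  have h3 : (2 * j + 1) % 2 = 1 := by omega
  have h4 : ¬ (2 * j + 2) % 2 = 1 := by omega
  simp only [gammaFac, h1, h2, h3, h4, if_true, if_false]
  split_ifs <;> first | omega | simp [matE_eq_one, matT_mul_self]

/-- The product `γ'_{2j+1} γ'_{2j+2}` acts as `UV` in a single slot. -/
theorem gammaM_mul_gammaM_succ (m j : ℕ) :
    gammaM m 0 (2 * j + 1) * gammaM m 0 (2 * j + 2) =
      kroneckerFamily fun a : Fin m => if (a : ℕ) = m - (j + 1) then matU * matV else 1 := by
  rw [gammaM_zero_right _ _ (by omega), gammaM_zero_right _ _ (by omega), kroneckerFamily_mul]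
  simp only [gammaFac_mul_gammaFac_succ]

theorem commute_gammaM_mul_gammaM_succ (m j k : ℕ) :
    Commute (gammaM m 0 (2 * j + 1) * gammaM m 0 (2 * j + 2))
      (gammaM m 0 (2 * k + 1) * gammaM m 0 (2 * k + 2)) := by
  simp only [Commute, SemiconjBy, gammaM_mul_gammaM_succ, kroneckerFamily_mul]
  congr 1
  funext a
  split_ifs <;> simp

theorem matU_mul_matV_mulVec_uVec {ε : ℤ} (hε : ε = 1 ∨ ε = -1) :
    (matU * matV).mulVec (uVec ε) = ((ε : ℂ) * Complex.I) • uVec ε := by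
  have h : (ε : ℂ) * ε = 1 := by rcases hε with rfl | rfl <;> simp
  ext t
  fin_cases t
  · simp [matU, matV, uVec, Matrix.mulVec, dotProduct]
  · simp [matU, matV, uVec, Matrix.mulVec, dotProduct]
    linear_combination (-(Real.sqrt 2 : ℂ)⁻¹) * h +
      (ε : ℂ) * ε * (Real.sqrt 2 : ℂ)⁻¹ * (Complex.I_mul_I)

theorem gammaM_mul_gammaM_succ_mulVec_uProd {m j : ℕ} (hj : j < m) {ε : ℤ}
    (hε : ε = 1 ∨ ε = -1) :
    (gammaM m 0 (2 * j + 1) * gammaM m 0 (2 * j + 2)).mulVec (uProd m fun _ => ε) =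
      ((ε : ℂ) * Complex.I) • uProd m fun _ => ε := by
  rw [gammaM_mul_gammaM_succ]
  unfold uProd
  rw [kroneckerFamily_mulVec _ fun _ => uVec ε]
  ext i
  have hslot : ∀ a : Fin m, ((if (a : ℕ) = m - (j + 1) then matU * matV else 1).mulVec
      (uVec ε)) (i a) =
      (if a = ⟨m - (j + 1), by omega⟩ then (ε : ℂ) * Complex.I else 1) * uVec ε (i a) := by
    intro a
    simp only [Fin.ext_iff]
    split_ifs
    · simp [matU_mul_matV_mulVec_uVec hε]
    · simp
  simp only [hslot, Finset.prod_mul_distrib, Pi.smul_apply, smul_eq_mul]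
  simp

theorem list_prod_mulVec_eq_smul {ι κ R : Type*} [Fintype κ] [DecidableEq κ] [CommSemiring R]
    (f : ι → Matrix κ κ R) (c : ι → R) (v : κ → R) (h : ∀ a, (f a).mulVec v = c a • v)
    (l : List ι) : (l.map f).prod.mulVec v = (l.map c).prod • v := by
  induction l with
  | nil => simp
  | cons a l ih =>
    simp [← Matrix.mulVec_mulVec, ih, Matrix.mulVec_smul, h, smul_smul, mul_comm]

theorem rotation_mulVec_uProd {m j : ℕ} (hj : j < m) {ε : ℤ} (hε : ε = 1 ∨ ε = -1) (t : ℝ) :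
    ((Real.cos (t / 2) : ℂ) • (1 : Matrix (Fin m → Fin 2) (Fin m → Fin 2) ℂ) +
      (Real.sin (t / 2) : ℂ) • (gammaM m 0 (2 * j + 1) * gammaM m 0 (2 * j + 2))).mulVec
        (uProd m fun _ => ε) =
      Complex.exp ((ε : ℂ) * Complex.I / 2 * t) • uProd m fun _ => ε := by
  rw [Matrix.add_mulVec, Matrix.smul_mulVec, Matrix.smul_mulVec, Matrix.one_mulVec,
    gammaM_mul_gammaM_succ_mulVec_uProd hj hε, smul_smul, ← add_smul]
  congr 1
  have h : (ε : ℂ) * Complex.I / 2 * t = ((ε * t / 2 : ℝ) : ℂ) * Complex.I := by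
    push_cast; ring
  rw [h, Complex.exp_mul_I, ← Complex.ofReal_cos, ← Complex.ofReal_sin]
  rcases hε with rfl | rfl
  · simp [mul_comm]
  · simp [neg_div]

/-- `[∏_α (cos(θ_α/2)·I + sin(θ_α/2)·γ'_{2α-1}γ'_{2α})] u(ε,…,ε)
= e^{(iε/2) Σ_α θ_α} u(ε,…,ε)` (the factors commute); hence the element
`ℓ(A) = e^{(i/2)Σθ_α} ∏_α (cos(θ_α/2) + sin(θ_α/2)γ'_{2α-1}γ'_{2α})` associated with
`A = diag(e^{iθ_1},…,e^{iθ_n})` fixes `u(-1,…,-1)` and multiplies `u(1,…,1)` by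
`det A = e^{i Σ_α θ_α}`. -/
theorem ell_action_on_extreme_spinors (n : ℕ) (hn : 1 ≤ n) (θ : Fin n → ℝ)
    (ε : ℤ) (hε : ε = 1 ∨ ε = -1)
    (f : Fin n → Matrix (Fin n → Fin 2) (Fin n → Fin 2) ℂ)
    (hf : f = fun α => (Real.cos (θ α / 2) : ℂ) • 1 +
      (Real.sin (θ α / 2) : ℂ) • (gammaM n 0 (2 * (α : ℕ) + 1) * gammaM n 0 (2 * (α : ℕ) + 2)))
    (M : Matrix (Fin n → Fin 2) (Fin n → Fin 2) ℂ)
    (hM : M = ((List.finRange n).map f).prod)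
    (ell : Matrix (Fin n → Fin 2) (Fin n → Fin 2) ℂ)
    (hell : ell = Complex.exp (Complex.I / 2 * ∑ α, (θ α : ℂ)) • M) :
    (∀ α β : Fin n, f α * f β = f β * f α) ∧
    M.mulVec (uProd n fun _ => ε) =
      Complex.exp ((ε : ℂ) * Complex.I / 2 * ∑ α, (θ α : ℂ)) • uProd n (fun _ => ε) ∧
    ell.mulVec (uProd n fun _ => -1) = uProd n (fun _ => -1) ∧
    ell.mulVec (uProd n fun _ => 1) =
      (Matrix.diagonal fun α => Complex.exp (Complex.I * (θ α : ℂ))).det •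
        uProd n (fun _ => 1) ∧
    (Matrix.diagonal fun α => Complex.exp (Complex.I * (θ α : ℂ))).det =
      Complex.exp (Complex.I * ∑ α, (θ α : ℂ)) := by
  have hdet : (Matrix.diagonal fun α => Complex.exp (Complex.I * (θ α : ℂ))).det =
      Complex.exp (Complex.I * ∑ α, (θ α : ℂ)) := by
    rw [Matrix.det_diagonal, ← Complex.exp_sum, Finset.mul_sum]
  have hact : ∀ δ : ℤ, δ = 1 ∨ δ = -1 → M.mulVec (uProd n fun _ => δ) =
      Complex.exp ((δ : ℂ) * Complex.I / 2 * ∑ α, (θ α : ℂ)) • uProd n fun _ => δ := by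
    intro δ hδ
    rw [hM, list_prod_mulVec_eq_smul f
      (fun α => Complex.exp ((δ : ℂ) * Complex.I / 2 * (θ α : ℂ))), ← List.ofFn_eq_map,
      List.prod_ofFn, ← Complex.exp_sum, Finset.mul_sum]
    intro α
    rw [hf]
    exact rotation_mulVec_uProd α.isLt hδ (θ α)
  refine ⟨fun α β => ?_, hact ε hε, ?_, ?_, hdet⟩
  · rw [hf]
    have hcomm := commute_gammaM_mul_gammaM_succ n α β
    exact Commute.add_left
      (((Commute.one_left _).smul_left _))
      (Commute.add_right ((Commute.one_right _).smul_right _)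
        ((hcomm.smul_left _).smul_right _))
  · rw [hell, Matrix.smul_mulVec, hact (-1) (Or.inr rfl), smul_smul, ← Complex.exp_add]
    convert one_smul ℂ _
    convert Complex.exp_zero
    push_cast
    ring
  · rw [hell, Matrix.smul_mulVec, hact 1 (Or.inl rfl), smul_smul, ← Complex.exp_add, hdet]
    congr 2
    push_cast
    ring
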